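/- (Sub-Laplacian eigenfunction property.) For every λ ∈ ℤ∖{0}, q ∈ ℤ and ℓ ∈ ℕ, the smooth function F : ℝ³ → ℂ, F(a,b,c) = (√|λ|/λ) ∑_{k∈ℤ} e^{−2πiqk/λ} e^{2πi(λc+kb)} h_{ℓ,λ}(k/λ + a), satisfies the partial differential equation −(∂_a² F + (∂_b + a ∂_c)² F) = 2π|λ|(2ℓ+1) · F on all of ℝ³. -/

import Mathlib

open MeasureTheory Real Complex
open scoped ComplexConjugate

/-- Physicists' Hermite polynomial `H_ℓ(u) = (-1)^ℓ e^{u²} (d/du)^ℓ e^{-u²}`. -/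
noncomputable def hermitePoly (ℓ : ℕ) (u : ℝ) : ℝ :=
  (-1 : ℝ) ^ ℓ * Real.exp (u ^ 2) * iteratedDeriv ℓ (fun t : ℝ => Real.exp (-t ^ 2)) u

/-- Normalised Hermite function `h_ℓ(u) = (√π 2^ℓ ℓ!)^{-1/2} H_ℓ(u) e^{-u²/2}`. -/
noncomputable def hermiteFun (ℓ : ℕ) (u : ℝ) : ℝ :=
  (Real.sqrt π * 2 ^ ℓ * (ℓ.factorial : ℝ)) ^ (-(1 : ℝ) / 2) *
    hermitePoly ℓ u * Real.exp (-u ^ 2 / 2)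

/-- Rescaled Hermite function `h_{ℓ,λ}(u) = (2π|λ|)^{1/4} h_ℓ(√(2π|λ|) u)`. -/
noncomputable def hermiteScaled (ℓ : ℕ) (lam : ℤ) (u : ℝ) : ℝ :=
  (2 * π * |(lam : ℝ)|) ^ ((1 : ℝ) / 4) * hermiteFun ℓ (Real.sqrt (2 * π * |(lam : ℝ)|) * u)

/-- The left-invariant vector field `A = ∂_a` acting on functions of `(a,b,c) ∈ ℝ³`. -/
noncomputable def dA (F : ℝ × ℝ × ℝ → ℂ) : ℝ × ℝ × ℝ → ℂ :=
  fun x => deriv (fun t => F (t, x.2.1, x.2.2)) x.1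

/-- The left-invariant vector field `B = ∂_b + a ∂_c` acting on functions of `(a,b,c) ∈ ℝ³`. -/
noncomputable def dB (F : ℝ × ℝ × ℝ → ℂ) : ℝ × ℝ × ℝ → ℂ :=
  fun x => deriv (fun t => F (x.1, t, x.2.2)) x.2.1 +
    x.1 * deriv (fun t => F (x.1, x.2.1, t)) x.2.2

section HermitePolynomial

open Polynomial

/-- The physicists' Hermite polynomials as elements of `ℝ[X]`. -/
noncomputable def physHermite : ℕ → ℝ[X]
  | 0 => 1
  | n + 1 => 2 * X * physHermite n - derivative (physHermite n)

theorem derivative_derivative_physHermite (n : ℕ) :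
    derivative (derivative (physHermite n)) =
      2 * X * derivative (physHermite n) - 2 * (n : ℝ[X]) * physHermite n := by
  induction n with
  | zero => simp [physHermite]
  | succ n ih =>
    have h : derivative (physHermite (n + 1)) = 2 * ((n : ℝ[X]) + 1) * physHermite n := by
      simp only [physHermite, derivative_sub, derivative_mul, derivative_X, derivative_ofNat, ih]
      ring
    have h' : derivative (2 * ((n : ℝ[X]) + 1) * physHermite n) =
        2 * ((n : ℝ[X]) + 1) * derivative (physHermite n) := by
      simp [derivative_mul]
    rw [h, h', physHermite]
    push_cast
    ring

theorem iteratedDeriv_exp_neg_sq (n : ℕ) :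
    iteratedDeriv n (fun t : ℝ => Real.exp (-t ^ 2)) =
      fun u => (-1) ^ n * (physHermite n).eval u * Real.exp (-u ^ 2) := by
  induction n with
  | zero => simp [physHermite]
  | succ n ih =>
    rw [iteratedDeriv_succ, ih]
    funext u
    have h := (((physHermite n).hasDerivAt u).const_mul ((-1 : ℝ) ^ n)).mul
      (((hasDerivAt_id u).pow 2).neg.exp)
    refine (h.congr_deriv ?_).deriv
    simp [physHermite]
    ring

theorem hermitePoly_eq_eval (n : ℕ) (u : ℝ) : hermitePoly n u = (physHermite n).eval u := by
  have h : ((-1 : ℝ) ^ n) * (-1) ^ n = 1 := by rw [← mul_pow]; simp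
  have h' : Real.exp (u ^ 2) * Real.exp (-u ^ 2) = 1 := by rw [← Real.exp_add]; simp
  rw [hermitePoly, iteratedDeriv_exp_neg_sq]
  linear_combination (physHermite n).eval u * (Real.exp (u ^ 2) * Real.exp (-u ^ 2)) * h +
    (physHermite n).eval u * h'

end HermitePolynomial

section GaussianPolynomial

open Polynomial

/-- The product of the polynomial `P` and the Gaussian `e^{-αu²}`. -/
noncomputable def gaussPoly (α : ℝ) (P : ℂ[X]) (u : ℝ) : ℂ :=
  P.eval (u : ℂ) * (Real.exp (-(α * u ^ 2)) : ℂ)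

theorem hasDerivAt_gaussPoly (α : ℝ) (P : ℂ[X]) (u : ℝ) :
    HasDerivAt (gaussPoly α P)
      (gaussPoly α (derivative P - C (2 * (α : ℂ)) * X * P) u) u := by
  have h := ((P.hasDerivAt (u : ℂ)).comp_ofReal).mul
    ((((hasDerivAt_id u).pow 2).const_mul α).neg.exp.ofReal_comp)
  refine h.congr_deriv ?_
  simp [gaussPoly]
  ring

theorem abs_pow_mul_exp_neg_mul_sq_le {α : ℝ} (hα : 0 < α) (n : ℕ) (u : ℝ) :
    |u| ^ n * Real.exp (-(α * u ^ 2)) ≤ 1 + n.factorial / α ^ n := by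
  have h1 : |u| ^ n ≤ 1 + (u ^ 2) ^ n := by
    have : (u ^ 2) ^ n = (|u| ^ n) ^ 2 := by rw [← sq_abs]; ring
    rw [this]
    nlinarith [sq_nonneg (|u| ^ n - 1)]
  have h2 := Real.pow_div_factorial_le_exp (α * u ^ 2) (by positivity) n
  have hf : (0 : ℝ) < n.factorial := by positivity
  have h3 : (u ^ 2) ^ n ≤ n.factorial / α ^ n * Real.exp (α * u ^ 2) := by
    rw [div_le_iff₀ hf, mul_pow] at h2
    rw [div_mul_eq_mul_div, le_div_iff₀ (by positivity)]
    linarith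
  have h4 : 1 ≤ Real.exp (α * u ^ 2) := Real.one_le_exp (by positivity)
  rw [Real.exp_neg, ← div_eq_mul_inv, div_le_iff₀ (Real.exp_pos _)]
  nlinarith

theorem exists_norm_gaussPoly_le {α : ℝ} (hα : 0 < α) (P : ℂ[X]) :
    ∃ M : ℝ, ∀ u : ℝ, ‖gaussPoly α P u‖ ≤ M := by
  induction P using Polynomial.induction_on' with
  | add p q hp hq =>
    obtain ⟨M, hM⟩ := hp
    obtain ⟨N, hN⟩ := hq
    refine ⟨M + N, fun u => ?_⟩
    have : gaussPoly α (p + q) u = gaussPoly α p u + gaussPoly α q u := by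
      simp [gaussPoly, add_mul]
    rw [this]
    exact (norm_add_le _ _).trans (add_le_add (hM u) (hN u))
  | monomial n a =>
    refine ⟨‖a‖ * (1 + n.factorial / α ^ n), fun u => ?_⟩
    have := abs_pow_mul_exp_neg_mul_sq_le hα n u
    rw [gaussPoly, eval_monomial, norm_mul, norm_mul, norm_pow, Complex.norm_real,
      Complex.norm_real, Real.norm_eq_abs, Real.norm_eq_abs, Real.abs_exp, mul_assoc]
    gcongr

theorem exists_norm_gaussPoly_le_inv {α : ℝ} (hα : 0 < α) (P : ℂ[X]) (R : ℝ) :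
    ∃ M : ℝ, ∀ x a : ℝ, |a| ≤ R → ‖gaussPoly α P (x + a)‖ ≤ M * (1 + x ^ 2)⁻¹ := by
  obtain ⟨M, hM⟩ := exists_norm_gaussPoly_le hα ((1 + X ^ 2) * P)
  have hM0 : 0 ≤ M := (norm_nonneg _).trans (hM 0)
  refine ⟨M * (2 * (1 + R ^ 2)), fun x a ha => ?_⟩
  have h := hM (x + a)
  have hmul : gaussPoly α ((1 + X ^ 2) * P) (x + a) =
      ((1 + (x + a) ^ 2 : ℝ) : ℂ) * gaussPoly α P (x + a) := by
    simp [gaussPoly]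
    ring
  rw [hmul, norm_mul, Complex.norm_real, Real.norm_of_nonneg (by positivity)] at h
  have haR : a ^ 2 ≤ R ^ 2 := sq_le_sq' (abs_le.mp ha).1 (abs_le.mp ha).2
  have hx : 1 + x ^ 2 ≤ 2 * (1 + R ^ 2) * (1 + (x + a) ^ 2) := by
    nlinarith [sq_nonneg (x + 2 * a), mul_nonneg (sq_nonneg R) (sq_nonneg (x + a))]
  rw [← div_eq_mul_inv, le_div_iff₀ (by positivity)]
  calc ‖gaussPoly α P (x + a)‖ * (1 + x ^ 2)
      ≤ ‖gaussPoly α P (x + a)‖ * (2 * (1 + R ^ 2) * (1 + (x + a) ^ 2)) := by gcongr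
    _ = (1 + (x + a) ^ 2) * ‖gaussPoly α P (x + a)‖ * (2 * (1 + R ^ 2)) := by ring
    _ ≤ M * (2 * (1 + R ^ 2)) := by gcongr

theorem summable_inv_one_add_div_sq {lam : ℤ} (hlam : lam ≠ 0) :
    Summable fun k : ℤ => (1 + ((k : ℝ) / (lam : ℝ)) ^ 2)⁻¹ := by
  have h : Summable fun k : ℤ => (lam : ℝ) ^ 2 * (1 / (k : ℝ) ^ 2) :=
    (Real.summable_one_div_int_pow.mpr one_lt_two).mul_left _
  refine h.of_norm_bounded_eventually ?_
  have hl : (0 : ℝ) < (lam : ℝ) ^ 2 := by positivity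
  filter_upwards [(Set.finite_singleton (0 : ℤ)).compl_mem_cofinite] with k hk
  have hk : (0 : ℝ) < (k : ℝ) ^ 2 := by
    have : k ≠ 0 := hk
    positivity
  rw [Real.norm_of_nonneg (by positivity), mul_one_div, div_pow, inv_eq_one_div,
    div_le_div_iff₀ (by positivity) hk]
  field_simp
  nlinarith

end GaussianPolynomial

section Theta

open Polynomial

/-- The `k`-th term of the series `gaussTheta`. -/
noncomputable def gaussThetaTerm (α : ℝ) (lam : ℤ) (w : ℤ → ℂ) (P : ℂ[X]) (k : ℤ)
    (y : ℝ × ℝ × ℝ) : ℂ :=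
  w k * Complex.exp (2 * (π : ℂ) * Complex.I *
    ((lam : ℂ) * (y.2.2 : ℂ) + (k : ℂ) * (y.2.1 : ℂ))) *
      gaussPoly α P ((k : ℝ) / (lam : ℝ) + y.1)

/-- The theta-type series
`∑_{k∈ℤ} w_k e^{2πi(λc+kb)} P(k/λ + a) e^{-α(k/λ+a)²}` on the Heisenberg group. -/
noncomputable def gaussTheta (α : ℝ) (lam : ℤ) (w : ℤ → ℂ) (P : ℂ[X]) (y : ℝ × ℝ × ℝ) : ℂ :=
  ∑' k : ℤ, gaussThetaTerm α lam w P k y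

variable {α : ℝ} {lam : ℤ} {w : ℤ → ℂ}

theorem exists_summable_bound_gaussThetaTerm (hα : 0 < α) (hlam : lam ≠ 0)
    (hw : ∀ k, ‖w k‖ ≤ 1) (P : ℂ[X]) (R : ℝ) :
    ∃ v : ℤ → ℝ, Summable v ∧
      ∀ k (y : ℝ × ℝ × ℝ), |y.1| ≤ R → ‖gaussThetaTerm α lam w P k y‖ ≤ v k := by
  obtain ⟨M, hM⟩ := exists_norm_gaussPoly_le_inv hα P R
  refine ⟨_, (summable_inv_one_add_div_sq hlam).mul_left M, fun k y hy => ?_⟩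
  have hexp : ‖Complex.exp (2 * (π : ℂ) * Complex.I *
      ((lam : ℂ) * (y.2.2 : ℂ) + (k : ℂ) * (y.2.1 : ℂ)))‖ = 1 := by
    rw [← Complex.norm_exp_ofReal_mul_I (2 * π * (lam * y.2.2 + k * y.2.1))]
    push_cast
    ring_nf
  rw [gaussThetaTerm, norm_mul, norm_mul, hexp, mul_one]
  exact (mul_le_of_le_one_left (norm_nonneg _) (hw k)).trans (hM _ _ hy)

theorem summable_gaussThetaTerm (hα : 0 < α) (hlam : lam ≠ 0) (hw : ∀ k, ‖w k‖ ≤ 1)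
    (P : ℂ[X]) (y : ℝ × ℝ × ℝ) : Summable fun k => gaussThetaTerm α lam w P k y := by
  obtain ⟨v, hv, hle⟩ := exists_summable_bound_gaussThetaTerm hα hlam hw P |y.1|
  exact hv.of_norm_bounded fun k => hle k y le_rfl

theorem gaussTheta_add (hα : 0 < α) (hlam : lam ≠ 0) (hw : ∀ k, ‖w k‖ ≤ 1)
    (P Q : ℂ[X]) (y : ℝ × ℝ × ℝ) :
    gaussTheta α lam w (P + Q) y = gaussTheta α lam w P y + gaussTheta α lam w Q y := by
  rw [gaussTheta, gaussTheta, gaussTheta, ← (summable_gaussThetaTerm hα hlam hw P y).tsum_add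
    (summable_gaussThetaTerm hα hlam hw Q y)]
  refine tsum_congr fun k => ?_
  simp only [gaussThetaTerm, gaussPoly, eval_add]
  ring

theorem gaussTheta_C_mul (z : ℂ) (P : ℂ[X]) (y : ℝ × ℝ × ℝ) :
    gaussTheta α lam w (C z * P) y = z * gaussTheta α lam w P y := by
  rw [gaussTheta, gaussTheta, ← tsum_mul_left]
  refine tsum_congr fun k => ?_
  simp only [gaussThetaTerm, gaussPoly, eval_mul, eval_C]
  ring

theorem dA_gaussTheta (hα : 0 < α) (hlam : lam ≠ 0) (hw : ∀ k, ‖w k‖ ≤ 1) (P : ℂ[X]) :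
    dA (gaussTheta α lam w P) =
      gaussTheta α lam w (derivative P - C (2 * (α : ℂ)) * X * P) := by
  funext ⟨a, b, c⟩
  obtain ⟨v, hv, hle⟩ := exists_summable_bound_gaussThetaTerm hα hlam hw
    (derivative P - C (2 * (α : ℂ)) * X * P) (|a| + 1)
  refine (hasDerivAt_tsum_of_isPreconnected (t := Metric.ball a 1) (y₀ := a)
    (g := fun k t => gaussThetaTerm α lam w P k (t, b, c))
    (g' := fun k t => gaussThetaTerm α lam w
      (derivative P - C (2 * (α : ℂ)) * X * P) k (t, b, c))
    hv Metric.isOpen_ball (convex_ball a 1).isPreconnected (fun k t _ => ?_) (fun k t ht => ?_)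
    (Metric.mem_ball_self one_pos) (summable_gaussThetaTerm hα hlam hw P _)
    (Metric.mem_ball_self one_pos)).deriv
  · exact ((hasDerivAt_gaussPoly α P _).comp_const_add ((k : ℝ) / (lam : ℝ)) t).const_mul
      (w k * Complex.exp (2 * (π : ℂ) * Complex.I * ((lam : ℂ) * (c : ℂ) + (k : ℂ) * (b : ℂ))))
  · refine hle k _ ?_
    have h : |t - a| < 1 := ht
    have := abs_add_le (t - a) a
    rw [sub_add_cancel] at this
    change |t| ≤ _
    linarith

theorem hasDerivAt_gaussTheta_snd (hα : 0 < α) (hlam : lam ≠ 0) (hw : ∀ k, ‖w k‖ ≤ 1)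
    (P : ℂ[X]) (a b c : ℝ) :
    HasDerivAt (fun t => gaussTheta α lam w P (a, t, c))
      (gaussTheta α lam w (C (2 * (π : ℂ) * Complex.I * lam) * (X - C (a : ℂ)) * P) (a, b, c))
      b := by
  obtain ⟨v, hv, hle⟩ := exists_summable_bound_gaussThetaTerm hα hlam hw
    (C (2 * (π : ℂ) * Complex.I * lam) * (X - C (a : ℂ)) * P) |a|
  refine hasDerivAt_tsum (y₀ := b)
    (g := fun k t => gaussThetaTerm α lam w P k (a, t, c))
    (g' := fun k t => gaussThetaTerm α lam w
      (C (2 * (π : ℂ) * Complex.I * lam) * (X - C (a : ℂ)) * P) k (a, t, c))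
    hv (fun k t => ?_) (fun k t => hle k _ le_rfl) (summable_gaussThetaTerm hα hlam hw P _) b
  have h := ((((((hasDerivAt_id t).ofReal_comp).const_mul (k : ℂ)).const_add
    ((lam : ℂ) * (c : ℂ))).const_mul (2 * (π : ℂ) * Complex.I)).cexp.const_mul
      (w k)).mul_const (gaussPoly α P ((k : ℝ) / (lam : ℝ) + a))
  refine h.congr_deriv ?_
  have hl : (lam : ℂ) ≠ 0 := by exact_mod_cast hlam
  simp only [gaussThetaTerm, gaussPoly, eval_mul, eval_sub, eval_C, eval_X, id]
  push_cast
  field_simp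
  ring

theorem hasDerivAt_gaussTheta_thd (P : ℂ[X]) (a b c : ℝ) :
    HasDerivAt (fun t => gaussTheta α lam w P (a, b, t))
      (2 * (π : ℂ) * Complex.I * lam * gaussTheta α lam w P (a, b, c)) c := by
  have hfac : ∀ t : ℝ, gaussTheta α lam w P (a, b, t) =
      Complex.exp (2 * (π : ℂ) * Complex.I * lam * (t : ℂ)) *
        gaussTheta α lam w P (a, b, 0) := fun t => by
    rw [gaussTheta, gaussTheta, ← tsum_mul_left]
    refine tsum_congr fun k => ?_
    simp only [gaussThetaTerm, mul_add, Complex.exp_add]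
    simp
    ring_nf
  rw [funext hfac, hfac c]
  have h := ((((hasDerivAt_id c).ofReal_comp).const_mul
    (2 * (π : ℂ) * Complex.I * lam)).cexp).mul_const (gaussTheta α lam w P (a, b, 0))
  refine h.congr_deriv ?_
  simp only [id]
  push_cast
  ring

theorem dB_gaussTheta (hα : 0 < α) (hlam : lam ≠ 0) (hw : ∀ k, ‖w k‖ ≤ 1) (P : ℂ[X]) :
    dB (gaussTheta α lam w P) =
      gaussTheta α lam w (C (2 * (π : ℂ) * Complex.I * lam) * (X * P)) := by
  funext ⟨a, b, c⟩
  have h : C (2 * (π : ℂ) * Complex.I * lam) * (X * P) =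
      C (2 * (π : ℂ) * Complex.I * lam) * (X - C (a : ℂ)) * P +
        C ((a : ℂ) * (2 * (π : ℂ) * Complex.I * lam)) * P := by
    simp only [C_mul]
    ring
  simp only [dB]
  rw [(hasDerivAt_gaussTheta_snd hα hlam hw P a b c).deriv,
    (hasDerivAt_gaussTheta_thd P a b c).deriv, h, gaussTheta_add hα hlam hw,
    gaussTheta_C_mul ((a : ℂ) * (2 * (π : ℂ) * Complex.I * lam))]
  ring

/-- If `P e^{-αu²}` is an eigenfunction of the harmonic oscillator with `α = π|λ|`, the theta
series of `P` is an eigenfunction of the sub-Laplacian. -/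
theorem subLaplacian_gaussTheta (hα : 0 < α) (hαlam : α ^ 2 = π ^ 2 * (lam : ℝ) ^ 2)
    (hlam : lam ≠ 0) (hw : ∀ k, ‖w k‖ ≤ 1) {P : ℂ[X]} {ℓ : ℕ}
    (hP : derivative (derivative P) =
      C (4 * (α : ℂ)) * X * derivative P - C (4 * (α : ℂ) * ℓ) * P) (y : ℝ × ℝ × ℝ) :
    -(dA (dA (gaussTheta α lam w P)) y + dB (dB (gaussTheta α lam w P)) y) =
      ((2 * α * (2 * (ℓ : ℝ) + 1) : ℝ) : ℂ) * gaussTheta α lam w P y := by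
  have hsq : (2 * (π : ℂ) * Complex.I * lam) ^ 2 = -(4 * (α : ℂ) ^ 2) := by
    have : (α : ℂ) ^ 2 = (π : ℂ) ^ 2 * (lam : ℂ) ^ 2 := by exact_mod_cast hαlam
    rw [this]
    linear_combination (4 * (π : ℂ) ^ 2 * (lam : ℂ) ^ 2) * Complex.I_sq
  have hCsq := congrArg (C : ℂ → ℂ[X]) hsq
  rw [dA_gaussTheta hα hlam hw, dA_gaussTheta hα hlam hw, dB_gaussTheta hα hlam hw,
    dB_gaussTheta hα hlam hw, ← gaussTheta_add hα hlam hw, ← gaussTheta_C_mul, ← neg_one_mul,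
    ← gaussTheta_C_mul]
  congr 1
  simp only [derivative_sub, derivative_mul, derivative_C, derivative_X, hP]
  push_cast
  simp only [C_mul, C_neg, C_pow, C_add, C_1, map_natCast, map_ofNat] at hCsq ⊢
  linear_combination (-X ^ 2 * P) * hCsq

theorem derivative_derivative_physHermite_comp {s : ℝ} (hs : s ^ 2 = 2 * α) (z : ℂ) (ℓ : ℕ) :
    derivative (derivative (C z * ((physHermite ℓ).map Complex.ofRealHom).comp (C (s : ℂ) * X))) =
      C (4 * (α : ℂ)) * X *
        derivative (C z * ((physHermite ℓ).map Complex.ofRealHom).comp (C (s : ℂ) * X)) -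
      C (4 * (α : ℂ) * ℓ) *
        (C z * ((physHermite ℓ).map Complex.ofRealHom).comp (C (s : ℂ) * X)) := by
  have hs' : (s : ℂ) ^ 2 = 2 * (α : ℂ) := by exact_mod_cast hs
  have hCs := congrArg (C : ℂ → ℂ[X]) hs'
  simp only [derivative_mul, derivative_comp, derivative_map, derivative_C, derivative_X,
    zero_mul, zero_add, mul_one, derivative_derivative_physHermite, Polynomial.map_sub, Polynomial.map_mul, map_X,
    Polynomial.map_natCast, Polynomial.map_ofNat, sub_comp, mul_comp, X_comp, natCast_comp,
    ofNat_comp, C_mul, C_pow, map_natCast, map_ofNat] at hCs ⊢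
  set H := ((physHermite ℓ).map Complex.ofRealHom).comp (C (s : ℂ) * X)
  set H' := ((derivative (physHermite ℓ)).map Complex.ofRealHom).comp (C (s : ℂ) * X)
  linear_combination C z * (2 * C (s : ℂ) * X * H' - 2 * (ℓ : ℂ[X]) * H) * hCs

theorem hermiteScaled_eq_gaussPoly (ℓ : ℕ) (lam : ℤ) : ∃ z : ℂ, ∀ u : ℝ,
    (hermiteScaled ℓ lam u : ℂ) = gaussPoly (π * |(lam : ℝ)|)
      (C z * ((physHermite ℓ).map Complex.ofRealHom).comp
        (C (Real.sqrt (2 * π * |(lam : ℝ)|) : ℂ) * X)) u := by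
  refine ⟨(((2 * π * |(lam : ℝ)|) ^ ((1 : ℝ) / 4) *
    (Real.sqrt π * 2 ^ ℓ * (ℓ.factorial : ℝ)) ^ (-(1 : ℝ) / 2) : ℝ) : ℂ), fun u => ?_⟩
  have hexp : -(Real.sqrt (2 * π * |(lam : ℝ)|) * u) ^ 2 / 2 = -(π * |(lam : ℝ)| * u ^ 2) := by
    rw [mul_pow, Real.sq_sqrt (by positivity)]
    ring
  have heval : (((physHermite ℓ).map Complex.ofRealHom).eval
      ((Real.sqrt (2 * π * |(lam : ℝ)|) : ℂ) * (u : ℂ))) =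
      (((physHermite ℓ).eval (Real.sqrt (2 * π * |(lam : ℝ)|) * u) : ℝ) : ℂ) := by
    rw [← Complex.ofReal_mul]
    exact eval_map_apply Complex.ofRealHom _
  simp only [hermiteScaled, hermiteFun, hermitePoly_eq_eval, hexp, gaussPoly, eval_mul, eval_C,
    eval_comp, eval_X, heval]
  push_cast
  ring

end Theta

/-- **Sub-Laplacian eigenfunction property**: the function
`F(a,b,c) = (√|λ|/λ) ∑_{k∈ℤ} e^{-2πiqk/λ} e^{2πi(λc+kb)} h_{ℓ,λ}(k/λ + a)` satisfies
`-(∂_a² F + (∂_b + a∂_c)² F) = 2π|λ|(2ℓ+1) F` on all of `ℝ³`. -/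
theorem subLaplacian_eigenfunction (lam : ℤ) (hlam : lam ≠ 0) (q : ℤ) (ℓ : ℕ) :
    ∀ x : ℝ × ℝ × ℝ,
      -(dA (dA (fun y : ℝ × ℝ × ℝ =>
            ((Real.sqrt |(lam : ℝ)| : ℝ) / (lam : ℝ) : ℝ) *
              ∑' k : ℤ,
                Complex.exp (-(2 * (π : ℂ) * Complex.I * (q : ℂ) * (k : ℂ)) / (lam : ℂ)) *
                  Complex.exp (2 * (π : ℂ) * Complex.I *
                    ((lam : ℂ) * (y.2.2 : ℂ) + (k : ℂ) * (y.2.1 : ℂ))) *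
                  (hermiteScaled ℓ lam ((k : ℝ) / (lam : ℝ) + y.1) : ℂ))) x +
        dB (dB (fun y : ℝ × ℝ × ℝ =>
            ((Real.sqrt |(lam : ℝ)| : ℝ) / (lam : ℝ) : ℝ) *
              ∑' k : ℤ,
                Complex.exp (-(2 * (π : ℂ) * Complex.I * (q : ℂ) * (k : ℂ)) / (lam : ℂ)) *
                  Complex.exp (2 * (π : ℂ) * Complex.I *
                    ((lam : ℂ) * (y.2.2 : ℂ) + (k : ℂ) * (y.2.1 : ℂ))) *
                  (hermiteScaled ℓ lam ((k : ℝ) / (lam : ℝ) + y.1) : ℂ))) x)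
      = ((2 * π * |(lam : ℝ)| * (2 * (ℓ : ℝ) + 1) : ℝ) : ℂ) *
          (((Real.sqrt |(lam : ℝ)| : ℝ) / (lam : ℝ) : ℝ) *
            ∑' k : ℤ,
              Complex.exp (-(2 * (π : ℂ) * Complex.I * (q : ℂ) * (k : ℂ)) / (lam : ℂ)) *
                Complex.exp (2 * (π : ℂ) * Complex.I *
                  ((lam : ℂ) * (x.2.2 : ℂ) + (k : ℂ) * (x.2.1 : ℂ))) *
                (hermiteScaled ℓ lam ((k : ℝ) / (lam : ℝ) + x.1) : ℂ)) := by
  have hl : (0 : ℝ) < |(lam : ℝ)| := abs_pos.mpr (by exact_mod_cast hlam)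
  have hα : 0 < π * |(lam : ℝ)| := by positivity
  obtain ⟨z, hz⟩ := hermiteScaled_eq_gaussPoly ℓ lam
  have hw : ∀ k : ℤ, ‖Complex.exp
      (-(2 * (π : ℂ) * Complex.I * (q : ℂ) * (k : ℂ)) / (lam : ℂ))‖ ≤ 1 := fun k => by
    rw [← Complex.norm_exp_ofReal_mul_I (-(2 * π * q * k) / lam)]
    push_cast
    apply le_of_eq
    ring_nf
  set r : ℂ := ((Real.sqrt |(lam : ℝ)| / (lam : ℝ) : ℝ) : ℂ)
  set s : ℝ := Real.sqrt (2 * π * |(lam : ℝ)|) with hs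
  have hs2 : s ^ 2 = 2 * (π * |(lam : ℝ)|) := by
    rw [hs, Real.sq_sqrt (by positivity)]
    ring
  have hF : ∀ y : ℝ × ℝ × ℝ,
      r * ∑' k : ℤ,
        Complex.exp (-(2 * (π : ℂ) * Complex.I * (q : ℂ) * (k : ℂ)) / (lam : ℂ)) *
          Complex.exp (2 * (π : ℂ) * Complex.I *
            ((lam : ℂ) * (y.2.2 : ℂ) + (k : ℂ) * (y.2.1 : ℂ))) *
          (hermiteScaled ℓ lam ((k : ℝ) / (lam : ℝ) + y.1) : ℂ) =
      gaussTheta (π * |(lam : ℝ)|) lam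
        (fun k => Complex.exp (-(2 * (π : ℂ) * Complex.I * (q : ℂ) * (k : ℂ)) / (lam : ℂ)))
        (Polynomial.C (r * z) * ((physHermite ℓ).map Complex.ofRealHom).comp
          (Polynomial.C (s : ℂ) * Polynomial.X)) y := fun y => by
    rw [Polynomial.C_mul, mul_assoc (Polynomial.C r), gaussTheta_C_mul]
    simp only [hz, gaussTheta, gaussThetaTerm]
  intro x
  simp only [hF]
  rw [mul_assoc 2 π]
  exact subLaplacian_gaussTheta hα (by rw [mul_pow, sq_abs]) hlam hw
    (derivative_derivative_physHermite_comp hs2 (r * z) ℓ) x
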